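/- arXiv:math/0609148 — 2 statements merged into one kernel-verified Lean document; each statement's English description precedes it below -/
import Mathlib

section
/- Let w and w' be braid words on n strands. If w and w' are B0-equivalent, then their linking matrices are equal: M(w) = M(w'). (This is the well-definedness half of Theorem 1: B0-equivalent braid words have the same braid diagram and hence the same linking matrix.) -/
open Matrix

/-- A letter of a braid word: a pair (column, sign). -/
abbrev Letter : Type := ℕ × ℤ

/-- A cycle on the laundry surface: `Sum.inl i` is the circle cycle `C_i` (1-indexed),
`Sum.inr k` is the band cycle `X_{k+1}` (i.e. the band of the letter in position `k`,
0-indexed). -/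
abbrev Cyc : Type := ℕ ⊕ ℕ

/-- `w` is a braid word on `n` strands: `n ≥ 2`, `w` nonempty, and each letter `(c, ε)`
has column `1 ≤ c ≤ n - 1` and sign `ε = ±1`. -/
def IsBraidWord (n : ℕ) (w : List Letter) : Prop :=
  2 ≤ n ∧ w ≠ [] ∧ ∀ ℓ ∈ w, 1 ≤ ℓ.1 ∧ ℓ.1 ≤ n - 1 ∧ (ℓ.2 = 1 ∨ ℓ.2 = -1)

/-- A single B0 move: swap two adjacent letters whose columns differ by more than 1. -/
inductive B0Step : List Letter → List Letter → Prop
  | swap (u v : List Letter) (a b : Letter)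
      (h : 1 < (a.1 : ℤ) - (b.1 : ℤ) ∨ 1 < (b.1 : ℤ) - (a.1 : ℤ)) :
      B0Step (u ++ a :: b :: v) (u ++ b :: a :: v)

/-- B0-equivalence: a finite sequence of B0 moves. -/
def B0Equiv : List Letter → List Letter → Prop := Relation.ReflTransGen B0Step

/-- The column of the `k`-th letter (0-indexed) of `w`. -/
def colOf (w : List Letter) (k : ℕ) : ℕ := (w.getD k (0, 0)).1

/-- The sign of the `k`-th letter (0-indexed) of `w`. -/
def signOf (w : List Letter) (k : ℕ) : ℤ := (w.getD k (0, 0)).2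

/-- The band cycles `X_k` with column `c_k ∈ {e - 1, e}`, in decreasing order of `k`. -/
def bandBlock (w : List Letter) (e : ℕ) : List Cyc :=
  ((List.range w.length).reverse.filter fun k => colOf w k == e - 1 || colOf w k == e).map
    Sum.inr

/-- The cycles of `w` in laundry order: for each even `e = 2, 4, …, ≤ n` in increasing
order, the circle `C_e` followed by all bands `X_k` with `c_k ∈ {e-1, e}` in decreasing
order of `k`; then the circles `C_i` for odd `i ≤ n` in decreasing order of `i`. -/
def laundryList (n : ℕ) (w : List Letter) : List Cyc :=
  (((List.range (n + 1)).filter fun e => e % 2 == 0 && e != 0).flatMap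
      fun e => Sum.inl e :: bandBlock w e) ++
    ((List.range (n + 1)).filter fun i => i % 2 == 1).reverse.map Sum.inl

/-- The linking number of (the double push-off of) one cycle of `w` with another. -/
def entry (w : List Letter) : Cyc → Cyc → ℤ
  | Sum.inl _, Sum.inl _ => 0
  | Sum.inr k, Sum.inr l =>
      if k = l then signOf w k
      else if (colOf w l = colOf w k + 1 ∧ k < l) ∨ (colOf w l + 1 = colOf w k ∧ l < k) then 1
      else 0
  | Sum.inr k, Sum.inl j =>
      if j = colOf w k then -1 else if j = colOf w k + 1 then 1 else 0
  | Sum.inl j, Sum.inr k =>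
      if j = colOf w k then -1 else if j = colOf w k + 1 then 1 else 0

/-- The linking matrix `M(w)` of a braid word `w` with `m` letters on `n` strands:
the `(n+m) × (n+m)` integer matrix of linking numbers, rows and columns indexed by the
cycles of `w` in laundry order. -/
def linkMat (n m : ℕ) (w : List Letter) : Matrix (Fin (n + m)) (Fin (n + m)) ℤ :=
  fun p q =>
    entry w ((laundryList n w).getD p (Sum.inl 0)) ((laundryList n w).getD q (Sum.inl 0))

theorem getD_swap_adjacent {α : Type*} (u v : List α) (a b d : α) (k : ℕ) :
    (u ++ b :: a :: v).getD (Equiv.swap u.length (u.length + 1) k) d =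
      (u ++ a :: b :: v).getD k d := by
  rcases lt_trichotomy k u.length with hk | rfl | hk
  · rw [Equiv.swap_apply_of_ne_of_ne (by omega) (by omega), List.getD_append _ _ _ _ hk,
      List.getD_append _ _ _ _ hk]
  · simp
  · obtain ⟨j, rfl⟩ : ∃ j, k = u.length + 1 + j := ⟨k - (u.length + 1), by omega⟩
    rcases j with _ | j
    · simp
    · rw [Equiv.swap_apply_of_ne_of_ne (by omega) (by omega),
        List.getD_append_right _ _ _ _ (by omega), List.getD_append_right _ _ _ _ (by omega),
        show u.length + 1 + (j + 1) - u.length = j + 2 by omega]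
      simp

theorem filter_map_swap_reverse_range (i r : ℕ) (p : ℕ → Bool)
    (h : ¬ (p i = true ∧ p (i + 1) = true)) :
    ((List.range (i + (2 + r))).reverse.map (Equiv.swap i (i + 1))).filter p =
      (List.range (i + (2 + r))).reverse.filter p := by
  have hlow : (List.range i).map (Equiv.swap i (i + 1)) = List.range i := by
    conv_rhs => rw [← List.map_id (List.range i)]
    refine List.map_congr_left fun k hk => ?_
    have := List.mem_range.1 hk
    exact Equiv.swap_apply_of_ne_of_ne (by omega) (by omega)
  have hhigh : ((List.range r).map fun k => i + (2 + k)).map (Equiv.swap i (i + 1)) =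
      (List.range r).map fun k => i + (2 + k) := by
    rw [List.map_map]
    refine List.map_congr_left fun k _ => ?_
    rw [Function.comp_apply]
    exact Equiv.swap_apply_of_ne_of_ne (by omega) (by omega)
  have hsplit : List.range (i + (2 + r)) =
      List.range i ++ ([i, i + 1] ++ (List.range r).map fun k => i + (2 + k)) := by
    rw [List.range_add, List.range_add]
    simp [List.range_succ, Function.comp_def]
  rw [List.map_reverse, List.filter_reverse, List.filter_reverse, hsplit, List.map_append,
    List.map_append, hlow, hhigh]
  congr 1
  simp only [List.filter_append]
  congr 2
  simp only [List.map_cons, List.map_nil, Equiv.swap_apply_left, Equiv.swap_apply_right,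
    List.filter_cons, List.filter_nil]
  cases hi : p i <;> cases hj : p (i + 1) <;> simp_all

section AdjacentSwap

variable (u v : List Letter) (a b : Letter)

theorem colOf_swap_adjacent (k : ℕ) :
    colOf (u ++ b :: a :: v) (Equiv.swap u.length (u.length + 1) k) =
      colOf (u ++ a :: b :: v) k := by
  rw [colOf, colOf, getD_swap_adjacent]

theorem signOf_swap_adjacent (k : ℕ) :
    signOf (u ++ b :: a :: v) (Equiv.swap u.length (u.length + 1) k) =
      signOf (u ++ a :: b :: v) k := by
  rw [signOf, signOf, getD_swap_adjacent]

theorem colOf_append_length : colOf (u ++ a :: v) u.length = a.1 := by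
  simp [colOf]

theorem colOf_append_length_succ :
    colOf (u ++ a :: b :: v) (u.length + 1) = b.1 := by
  simp [colOf]

theorem bandBlock_swap_adjacent
    (h : 1 < (a.1 : ℤ) - (b.1 : ℤ) ∨ 1 < (b.1 : ℤ) - (a.1 : ℤ))
    (e : ℕ) :
    bandBlock (u ++ b :: a :: v) e =
      (bandBlock (u ++ a :: b :: v) e).map
        (Sum.map id (Equiv.swap u.length (u.length + 1))) := by
  have hlen (x y : Letter) : (u ++ x :: y :: v).length = u.length + (2 + v.length) := by
    simp; omega
  unfold bandBlock
  rw [hlen, hlen, ← filter_map_swap_reverse_range, List.filter_map, List.map_map, List.map_map]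
  · simp only [Function.comp_def, colOf_swap_adjacent, Sum.map_inr]
  · rw [colOf_append_length, colOf_append_length_succ]
    simp only [Bool.or_eq_true, beq_iff_eq]
    omega

theorem laundryList_swap_adjacent
    (h : 1 < (a.1 : ℤ) - (b.1 : ℤ) ∨ 1 < (b.1 : ℤ) - (a.1 : ℤ))
    (n : ℕ) :
    laundryList n (u ++ b :: a :: v) =
      (laundryList n (u ++ a :: b :: v)).map
        (Sum.map id (Equiv.swap u.length (u.length + 1))) := by
  simp only [laundryList, List.map_append, List.map_flatMap, List.map_cons, List.map_map,
    bandBlock_swap_adjacent u v a b h, Sum.map_inl, id, Function.comp_def]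

theorem entry_swap_adjacent
    (h : 1 < (a.1 : ℤ) - (b.1 : ℤ) ∨ 1 < (b.1 : ℤ) - (a.1 : ℤ))
    (x y : Cyc) :
    entry (u ++ b :: a :: v) (Sum.map id (Equiv.swap u.length (u.length + 1)) x)
        (Sum.map id (Equiv.swap u.length (u.length + 1)) y) =
      entry (u ++ a :: b :: v) x y := by
  rcases x with i | k <;> rcases y with j | l
  · rfl
  · simp only [entry, Sum.map_inl, Sum.map_inr, id, colOf_swap_adjacent]
  · simp only [entry, Sum.map_inl, Sum.map_inr, id, colOf_swap_adjacent]
  · simp only [entry, Sum.map_inr, colOf_swap_adjacent, signOf_swap_adjacent,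
      EmbeddingLike.apply_eq_iff_eq]
    have ha := colOf_append_length u (b :: v) a
    have hb := colOf_append_length_succ u v a b
    congr 2
    simp only [Equiv.swap_apply_def]
    grind

end AdjacentSwap

theorem linkMat_eq_of_b0Step (n m : ℕ) {w w' : List Letter} (h : B0Step w w') :
    linkMat n m w = linkMat n m w' := by
  obtain ⟨u, v, a, b, hab⟩ := h
  ext p q
  have hget (k : ℕ) := List.getD_map (l := laundryList n (u ++ a :: b :: v)) (n := k)
    (d := Sum.inl 0) (f := Sum.map id (Equiv.swap u.length (u.length + 1)))
  simp only [Sum.map_inl, id] at hget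
  rw [linkMat, linkMat, laundryList_swap_adjacent u v a b hab, hget, hget,
    entry_swap_adjacent u v a b hab]

/-- B0-equivalent braid words on `n` strands have equal linking
matrices. -/
theorem linkMat_eq_of_b0Equiv (n m : ℕ) (w w' : List Letter)
    (hw : IsBraidWord n w) (hw' : IsBraidWord n w')
    (hm : w.length = m) (hm' : w'.length = m)
    (h : B0Equiv w w') :
    linkMat n m w = linkMat n m w' := by
  clear hw hw' hm hm'
  induction h with
  | refl => rfl
  | tail _ hs ih => exact ih.trans (linkMat_eq_of_b0Step n m hs)
end

section
/- Let w and w' be braid words on n strands with the same number of letters. If their linking matrices are equal, M(w) = M(w'), then w and w' are B0-equivalent. (This is the injectivity half of Theorem 1: the braid diagram can be recovered from the linking matrix — the twist of each band is its diagonal entry, the zero diagonal entries identify the circle cycles, property L1 determines the column of each band, and property L2 determines the order of the bands on each circle.) -/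
open Matrix

namespace B0Equiv

/-- Two letters commute under a B0 move when their columns differ by more than `1`. -/
def Far (a b : Letter) : Prop :=
  1 < (a.1 : ℤ) - (b.1 : ℤ) ∨ 1 < (b.1 : ℤ) - (a.1 : ℤ)

lemma cons {u v : List Letter} (a : Letter) (h : B0Equiv u v) : B0Equiv (a :: u) (a :: v) := by
  refine Relation.ReflTransGen.lift (List.cons a) ?_ _ _ h
  rintro _ _ ⟨s, t, b, c, hbc⟩
  exact B0Step.swap (a :: s) t b c hbc

lemma cons_append (a : Letter) (s u : List Letter) (h : ∀ x ∈ s, Far x a) :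
    B0Equiv (a :: (s ++ u)) (s ++ a :: u) := by
  induction s with
  | nil => exact Relation.ReflTransGen.refl
  | cons b s ih =>
    refine Relation.ReflTransGen.head (B0Step.swap [] (s ++ u) a b ?_)
      (cons b (ih fun x hx => h x (List.mem_cons_of_mem _ hx)))
    exact (h b List.mem_cons_self).symm

/-- Rearranging the letters of a word by a permutation that keeps the order of all pairs of
letters that do not commute yields a B0-equivalent word. -/
lemma map_of_perm (f : ℕ → Letter) (L L' : List ℕ) (hL : L.Pairwise (· < ·)) (hp : L.Perm L')
    (hL' : L'.Pairwise fun x y => ¬ Far (f x) (f y) → x < y) :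
    B0Equiv (L.map f) (L'.map f) := by
  induction L generalizing L' with
  | nil => rw [List.nil_perm.1 hp]; exact Relation.ReflTransGen.refl
  | cons a t ih =>
    obtain ⟨s, u, rfl⟩ := List.append_of_mem (hp.subset List.mem_cons_self)
    have hp' : t.Perm (s ++ u) := (hp.trans List.perm_middle).cons_inv
    rw [List.pairwise_cons] at hL
    have hsub : (s ++ u).Sublist (s ++ a :: u) :=
      (List.Sublist.refl s).append (List.sublist_cons_self a u)
    refine (cons (f a) (ih (s ++ u) hL.2 hp' (hL'.sublist hsub))).trans ?_
    rw [List.map_append, List.map_append, List.map_cons]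
    refine cons_append _ _ _ ?_
    intro y hy
    obtain ⟨x, hx, rfl⟩ := List.mem_map.1 hy
    by_contra hc
    have h1 : x < a := (List.pairwise_append.1 hL').2.2 x hx a List.mem_cons_self hc
    have h2 : a < x := hL.1 x (hp'.symm.subset (List.mem_append_left _ hx))
    omega

end B0Equiv

/-- Half the index of the block of the laundry order containing the bands in column `c`. -/
def blockOf (c : ℕ) : ℕ := (c + 1) / 2

lemma mem_bandBlock {w : List Letter} {e : ℕ} {x : Cyc} :
    x ∈ bandBlock w e ↔
      ∃ k, k < w.length ∧ (colOf w k = e - 1 ∨ colOf w k = e) ∧ x = Sum.inr k := by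
  simp only [bandBlock, List.mem_map, List.mem_filter, List.mem_reverse, List.mem_range,
    Bool.or_eq_true, beq_iff_eq]
  constructor
  · rintro ⟨k, ⟨h1, h2⟩, rfl⟩; exact ⟨k, h1, h2, rfl⟩
  · rintro ⟨k, h1, h2, rfl⟩; exact ⟨k, ⟨h1, h2⟩, rfl⟩

lemma IsBraidWord.letter {n : ℕ} {w : List Letter} (hw : IsBraidWord n w) {k : ℕ}
    (hk : k < w.length) :
    1 ≤ colOf w k ∧ colOf w k ≤ n - 1 ∧ (signOf w k = 1 ∨ signOf w k = -1) := by
  unfold colOf signOf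
  rw [List.getD_eq_getElem _ _ hk]
  exact hw.2.2 _ (List.getElem_mem hk)

lemma inl_mem_laundryList {n : ℕ} {w : List Letter} {i : ℕ} :
    Sum.inl i ∈ laundryList n w ↔ 1 ≤ i ∧ i ≤ n := by
  simp only [laundryList, List.mem_append, List.mem_flatMap, List.mem_filter, List.mem_range,
    List.mem_cons, mem_bandBlock, List.mem_map, List.mem_reverse, Bool.and_eq_true, beq_iff_eq,
    bne_iff_ne, Sum.inl.injEq, reduceCtorEq, and_false, exists_false, or_false, exists_eq_right]
  constructor
  · rintro (⟨e, h, rfl⟩ | h) <;> omega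
  · intro h
    rcases Nat.mod_two_eq_zero_or_one i with h' | h'
    · exact Or.inl ⟨i, by omega, rfl⟩
    · exact Or.inr (by omega)

lemma inr_mem_laundryList {n : ℕ} {w : List Letter} (hw : IsBraidWord n w) {k : ℕ} :
    Sum.inr k ∈ laundryList n w ↔ k < w.length := by
  simp only [laundryList, List.mem_append, List.mem_flatMap, List.mem_filter, List.mem_range,
    List.mem_cons, mem_bandBlock, List.mem_map, List.mem_reverse, Bool.and_eq_true, beq_iff_eq,
    bne_iff_ne, Sum.inr.injEq, reduceCtorEq, and_false, exists_false, or_false, false_or]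
  constructor
  · rintro ⟨e, -, l, hl, -, rfl⟩; exact hl
  · intro hk
    have := hw.letter hk
    have := hw.1
    exact ⟨2 * ((colOf w k + 1) / 2), by omega, k, hk, by omega, rfl⟩

lemma pairwise_bandBlock (w : List Letter) (e : ℕ) :
    (bandBlock w e).Pairwise fun x y => ∀ k l, x = Sum.inr k → y = Sum.inr l → l < k := by
  unfold bandBlock
  rw [List.pairwise_map]
  refine List.Pairwise.filter _ ?_
  rw [List.pairwise_reverse]
  refine List.pairwise_lt_range.imp ?_
  rintro a b h k l ⟨⟩ ⟨⟩
  exact h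

lemma pairwise_evens (n : ℕ) :
    ((List.range (n + 1)).filter fun e => e % 2 == 0 && e != 0).Pairwise (· < ·) :=
  List.pairwise_lt_range.filter _

lemma pairwise_laundryList (n : ℕ) (w : List Letter) :
    (laundryList n w).Pairwise fun x y => x ≠ y ∧ ∀ k l, x = Sum.inr k → y = Sum.inr l →
      blockOf (colOf w k) = blockOf (colOf w l) → l < k := by
  unfold laundryList
  rw [List.pairwise_append, List.pairwise_flatMap]
  refine ⟨⟨?_, ?_⟩, ?_, ?_⟩
  · intro e _
    rw [List.pairwise_cons]
    refine ⟨?_, ?_⟩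
    · intro y hy
      obtain ⟨k, -, -, rfl⟩ := mem_bandBlock.1 hy
      simp
    · refine (pairwise_bandBlock w e).imp_of_mem ?_
      intro x y hx hy h
      obtain ⟨k, -, -, rfl⟩ := mem_bandBlock.1 hx
      obtain ⟨l, -, -, rfl⟩ := mem_bandBlock.1 hy
      have hlk := h k l rfl rfl
      refine ⟨?_, fun a b ha hb _ => h a b ha hb⟩
      intro heq
      simp only [Sum.inr.injEq] at heq
      omega
  · refine (pairwise_evens n).imp_of_mem ?_
    intro e e' he he' hlt x hx y hy
    simp only [List.mem_filter, Bool.and_eq_true, beq_iff_eq, bne_iff_ne] at he he'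
    rw [List.mem_cons, mem_bandBlock] at hx hy
    rcases hx with rfl | ⟨k, -, hk, rfl⟩ <;> rcases hy with rfl | ⟨l, -, hl, rfl⟩
    · simp; omega
    · simp
    · simp
    · refine ⟨?_, ?_⟩
      · simp only [ne_eq, Sum.inr.injEq]
        rintro rfl
        omega
      · rintro _ _ ⟨⟩ ⟨⟩ h
        unfold blockOf at h
        omega
  · rw [List.pairwise_map, List.pairwise_reverse]
    refine (List.pairwise_lt_range.filter _).imp ?_
    intro a b h
    simp; omega
  · intro x hx y hy
    obtain ⟨i, hi, rfl⟩ := List.mem_map.1 hy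
    refine ⟨?_, by simp⟩
    rintro rfl
    obtain ⟨e, he, hx⟩ := List.mem_flatMap.1 hx
    simp only [List.mem_cons, mem_bandBlock, Sum.inl.injEq, reduceCtorEq, and_false, exists_false,
      or_false] at hx
    subst hx
    simp only [List.mem_filter, List.mem_reverse, Bool.and_eq_true, beq_iff_eq] at he hi
    omega

lemma nodup_laundryList (n : ℕ) (w : List Letter) : (laundryList n w).Nodup :=
  (pairwise_laundryList n w).imp fun h => h.1

lemma length_laundryList {n : ℕ} {w : List Letter} (hw : IsBraidWord n w) :
    (laundryList n w).length = n + w.length := by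
  have hp : (laundryList n w).Perm
      (((List.range n).map fun i => Sum.inl (i + 1)) ++ (List.range w.length).map Sum.inr) := by
    rw [List.perm_ext_iff_of_nodup (nodup_laundryList n w)]
    · rintro (i | k)
      · rw [inl_mem_laundryList]
        simp only [List.mem_append, List.mem_map, List.mem_range, Sum.inl.injEq, reduceCtorEq,
          and_false, exists_false, or_false]
        constructor
        · intro h; exact ⟨i - 1, by omega, by omega⟩
        · rintro ⟨j, h, rfl⟩; omega
      · rw [inr_mem_laundryList hw]
        simp
    · rw [List.nodup_append]
      refine ⟨List.nodup_range.map ?_, List.nodup_range.map Sum.inr_injective, ?_⟩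
      · intro a b h; simpa using h
      · simp
  simpa using hp.length_eq

/-- The circles occur in an order that depends only on the number of strands. -/
lemma filterMap_getLeft_laundryList (n : ℕ) (w w' : List Letter) :
    (laundryList n w).filterMap Sum.getLeft? = (laundryList n w').filterMap Sum.getLeft? := by
  have hb : ∀ (v : List Letter) (e : ℕ), (bandBlock v e).filterMap Sum.getLeft? = [] := by
    intro v e
    rw [List.filterMap_eq_nil_iff]
    intro x hx
    obtain ⟨k, -, -, rfl⟩ := mem_bandBlock.1 hx
    rfl
  simp only [laundryList, List.filterMap_append, List.filterMap_flatMap, List.filterMap_cons,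
    Sum.getLeft?_inl, hb]

lemma map_getLeft_eq {α β : Type*} (L L' : List (α ⊕ β))
    (h : L.map Sum.isLeft = L'.map Sum.isLeft)
    (h' : L.filterMap Sum.getLeft? = L'.filterMap Sum.getLeft?) :
    L.map Sum.getLeft? = L'.map Sum.getLeft? := by
  induction L generalizing L' with
  | nil => cases L' with
    | nil => rfl
    | cons b t' => simp at h
  | cons a t ih => cases L' with
    | nil => simp at h
    | cons b t' =>
      rw [List.map_cons, List.map_cons, List.cons.injEq] at h
      rcases a with a | a <;> rcases b with b | b <;>
        simp only [Sum.isLeft_inl, Sum.isLeft_inr, reduceCtorEq, false_and] at h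
      · simp only [List.filterMap_cons, Sum.getLeft?_inl, List.cons.injEq] at h'
        simp [h'.1, ih t' h.2 h'.2]
      · simp only [List.filterMap_cons, Sum.getLeft?_inr] at h'
        simp [ih t' h.2 h']

lemma exists_getD_of_mem {α : Type*} {L : List α} {N : ℕ} (hL : L.length = N) {x : α} (d : α)
    (hx : x ∈ L) : ∃ p : Fin N, L.getD p d = x := by
  obtain ⟨p, hp, rfl⟩ := List.getElem_of_mem hx
  exact ⟨⟨p, hL ▸ hp⟩, List.getD_eq_getElem _ _ hp⟩

lemma getD_mem_of_length {α : Type*} {L : List α} {N : ℕ} (hL : L.length = N) (d : α)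
    (p : Fin N) : L.getD p d ∈ L := by
  have hp : (p : ℕ) < L.length := hL ▸ p.2
  rw [List.getD_eq_getElem _ _ hp]
  exact List.getElem_mem hp

lemma pairwise_getD {α : Type*} {L : List α} {N : ℕ} (hL : L.length = N) (d : α)
    {R : α → α → Prop} (h : L.Pairwise R) {p q : Fin N} (hpq : p < q) :
    R (L.getD p d) (L.getD q d) := by
  have hp : (p : ℕ) < L.length := hL ▸ p.2
  have hq : (q : ℕ) < L.length := hL ▸ q.2
  rw [List.getD_eq_getElem _ _ hp, List.getD_eq_getElem _ _ hq]
  exact List.pairwise_iff_getElem.1 h p q hp hq hpq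

lemma isLeft_iff_entry_self {n : ℕ} {w : List Letter} (hw : IsBraidWord n w) {x : Cyc}
    (hx : x ∈ laundryList n w) : x.isLeft ↔ entry w x x = 0 := by
  rcases x with i | k
  · simp [entry]
  · have := hw.letter ((inr_mem_laundryList hw).1 hx)
    simp only [entry, Sum.isLeft_inr, if_true]
    constructor
    · simp
    · omega

/-- Braid words on `n` strands with the same number of letters and
equal linking matrices are B0-equivalent. -/
theorem b0Equiv_of_linkMat_eq (n m : ℕ) (w w' : List Letter)
    (hw : IsBraidWord n w) (hw' : IsBraidWord n w')
    (hm : w.length = m) (hm' : w'.length = m)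
    (h : linkMat n m w = linkMat n m w') :
    B0Equiv w w' := by
  have hN : (laundryList n w).length = n + m := by
    rw [length_laundryList hw, hm]
  have hN' : (laundryList n w').length = n + m := by
    rw [length_laundryList hw', hm']
  have hleft : (laundryList n w).map Sum.getLeft? = (laundryList n w').map Sum.getLeft? := by
    refine map_getLeft_eq _ _ ?_ (filterMap_getLeft_laundryList n w w')
    refine List.ext_getElem (by simp [hN, hN']) ?_
    intro p hp hp'
    rw [List.length_map] at hp hp'
    rw [List.getElem_map, List.getElem_map, Bool.eq_iff_iff,
      isLeft_iff_entry_self hw (List.getElem_mem hp),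
      isLeft_iff_entry_self hw' (List.getElem_mem hp')]
    have := congrFun (congrFun h ⟨p, hN ▸ hp⟩) ⟨p, hN ▸ hp⟩
    simp only [linkMat] at this
    rw [List.getD_eq_getElem _ _ hp, List.getD_eq_getElem _ _ hp'] at this
    rw [this]
  set F : Fin (n + m) → Cyc := fun p => (laundryList n w).getD p (Sum.inl 0) with hF
  set F' : Fin (n + m) → Cyc := fun p => (laundryList n w').getD p (Sum.inl 0) with hF'
  have hE : ∀ p q, entry w (F p) (F q) = entry w' (F' p) (F' q) :=
    fun p q => congrFun (congrFun h p) q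
  have hl : ∀ p, (F p).getLeft? = (F' p).getLeft? := by
    intro p
    have hp : (p : ℕ) < (laundryList n w).length := by omega
    have hp' : (p : ℕ) < (laundryList n w').length := by omega
    have := congrArg (fun L => L[(p : ℕ)]?) hleft
    simp only [List.getElem?_map, List.getElem?_eq_getElem hp, List.getElem?_eq_getElem hp',
      Option.map_some, Option.some.injEq] at this
    simpa only [hF, hF', List.getD_eq_getElem _ _ hp, List.getD_eq_getElem _ _ hp'] using this
  have hinj : ∀ p q, F p = F q → p = q := by
    intro p q hpq
    rcases lt_trichotomy p q with hlt | heq | hlt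
    · exact absurd hpq (pairwise_getD hN _ (nodup_laundryList n w) hlt)
    · exact heq
    · exact absurd hpq.symm (pairwise_getD hN _ (nodup_laundryList n w) hlt)
  have hex : ∀ k', ∃ k, k' < m → k < m ∧ ∃ p, F p = Sum.inr k ∧ F' p = Sum.inr k' := by
    intro k'
    by_cases hk' : k' < m
    · obtain ⟨p, hp⟩ := exists_getD_of_mem hN' (Sum.inl 0)
        ((inr_mem_laundryList hw').2 (hm'.symm ▸ hk'))
      have hmem := getD_mem_of_length hN (Sum.inl 0) p
      change F' p = _ at hp
      change F p ∈ _ at hmem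
      have hlp := hl p
      rw [hp] at hlp
      rcases hFp : F p with i | k
      · simp [hFp] at hlp
      · rw [hFp] at hmem
        exact ⟨k, fun _ => ⟨hm ▸ (inr_mem_laundryList hw).1 hmem, p, hFp, hp⟩⟩
    · exact ⟨0, fun hk => absurd hk hk'⟩
  choose ψ hψ using hex
  have hcol : ∀ k' < m, colOf w (ψ k') = colOf w' k' := by
    intro k' hk'
    obtain ⟨hk, p, hp, hp'⟩ := hψ k' hk'
    have hc := hw.letter (hm.symm ▸ hk)
    obtain ⟨q, hq⟩ := exists_getD_of_mem hN (Sum.inl 0)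
      ((inl_mem_laundryList (w := w) (n := n) (i := colOf w (ψ k'))).2 (by omega))
    change F q = _ at hq
    have hlq := hl q
    have hq' : F' q = Sum.inl (colOf w (ψ k')) := by
      rcases hFq : F' q with i | l <;> rw [hFq, hq] at hlq <;> simp_all
    have := hE p q
    rw [hp, hq, hp', hq'] at this
    simp only [entry, if_true] at this
    split_ifs at this <;> omega
  have hsign : ∀ k' < m, signOf w (ψ k') = signOf w' k' := by
    intro k' hk'
    obtain ⟨hk, p, hp, hp'⟩ := hψ k' hk'
    have := hE p p
    rw [hp, hp'] at this
    simpa [entry] using this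
  set f : ℕ → Letter := fun k => w.getD k (0, 0) with hf
  have hletter : ∀ k' < m, f (ψ k') = w'.getD k' (0, 0) :=
    fun k' hk' => Prod.ext (hcol k' hk') (hsign k' hk')
  have hψinj : ∀ k' < m, ∀ l' < m, ψ k' = ψ l' → k' = l' := by
    intro k' hk' l' hl' heq
    obtain ⟨-, p, hp, hp'⟩ := hψ k' hk'
    obtain ⟨-, q, hq, hq'⟩ := hψ l' hl'
    obtain rfl := hinj p q (by rw [hp, hq, heq])
    exact Sum.inr_injective (hp'.symm.trans hq')
  have hmono : ∀ k' < m, ∀ l' < m, k' < l' → ¬ B0Equiv.Far (f (ψ k')) (f (ψ l')) →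
      ψ k' < ψ l' := by
    intro k' hk' l' hl' hlt hfar
    have hne : ψ k' ≠ ψ l' := fun heq => hlt.ne (hψinj k' hk' l' hl' heq)
    have hck := hcol k' hk'
    have hcl := hcol l' hl'
    obtain ⟨hk, p, hp, hp'⟩ := hψ k' hk'
    obtain ⟨hl, q, hq, hq'⟩ := hψ l' hl'
    change ¬ (1 < (colOf w (ψ k') : ℤ) - (colOf w (ψ l') : ℤ) ∨
      1 < (colOf w (ψ l') : ℤ) - (colOf w (ψ k') : ℤ)) at hfar
    by_cases hblock : blockOf (colOf w' k') = blockOf (colOf w' l')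
    · have hpq : q < p := by
        rcases lt_trichotomy p q with h1 | rfl | h1
        · have := (pairwise_getD hN' (Sum.inl 0) (pairwise_laundryList n w') h1).2 k' l' hp' hq'
            hblock
          omega
        · exact absurd (Sum.inr_injective (hp.symm.trans hq)) hne
        · exact h1
      exact (pairwise_getD hN (Sum.inl 0) (pairwise_laundryList n w) hpq).2 _ _ hq hp
        (by rw [hck, hcl, hblock])
    · have hc : colOf w' k' ≠ colOf w' l' := fun hc => hblock (by rw [hc])
      have := hE p q
      rw [hp, hq, hp', hq'] at this
      simp only [entry, if_neg hne, if_neg hlt.ne, hck, hcl] at this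
      rw [hck, hcl] at hfar
      split_ifs at this <;> omega
  have hword : (List.range m).map f = w := by
    refine List.ext_getElem (by simp [hm]) ?_
    intro i h1 h2
    simp [hf, h2]
  have hword' : ((List.range m).map ψ).map f = w' := by
    refine List.ext_getElem (by simp [hm']) ?_
    intro i h1 h2
    simp [hletter i (hm' ▸ h2), h2]
  have hnodup : ((List.range m).map ψ).Nodup := by
    refine List.Nodup.map_on ?_ List.nodup_range
    simpa using hψinj
  have hperm : (List.range m).Perm ((List.range m).map ψ) := by
    refine ((hnodup.subperm ?_).perm_of_length_le (by simp)).symm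
    intro x hx
    obtain ⟨k', hk', rfl⟩ := List.mem_map.1 hx
    exact List.mem_range.2 (hψ k' (List.mem_range.1 hk')).1
  rw [← hword', ← hword]
  refine B0Equiv.map_of_perm f _ _ List.pairwise_lt_range hperm ?_
  rw [List.pairwise_map]
  refine List.pairwise_lt_range.imp_of_mem ?_
  intro a b ha hb hab
  exact hmono a (List.mem_range.1 ha) b (List.mem_range.1 hb) hab
end
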